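/- Let M be a positive integer and let 𝕄 ∈ ℝ^{M×M} be a Metzler matrix. Then 𝕄 is Hurwitz if and only if there exists a vector ν ∈ ℝ^M with all entries strictly positive such that every entry of 𝕄ν is strictly negative. -/

import Mathlib

open Matrix

/-- A real square matrix is Metzler if all of its off-diagonal entries are nonnegative. -/
def Matrix.IsMetzler {M : ℕ} (A : Matrix (Fin M) (Fin M) ℝ) : Prop :=
  ∀ i j, i ≠ j → 0 ≤ A i j

/-- A real square matrix is Hurwitz if every eigenvalue (i.e., every complex root of its
characteristic polynomial) has strictly negative real part. -/
def Matrix.IsHurwitz {M : ℕ} (A : Matrix (Fin M) (Fin M) ℝ) : Prop :=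
  ∀ μ : ℂ, ((A.map (algebraMap ℝ ℂ)).charpoly).IsRoot μ → μ.re < 0

namespace Matrix

theorem isHurwitz_of_exists_pos_vec {M : ℕ} {A : Matrix (Fin M) (Fin M) ℝ} (hA : A.IsMetzler)
    {ν : Fin M → ℝ} (hν : ∀ i, 0 < ν i) (hAν : ∀ i, (A *ᵥ ν) i < 0) : A.IsHurwitz := by
  intro μ hμ
  rw [Polynomial.IsRoot, eval_charpoly, ← exists_mulVec_eq_zero_iff] at hμ
  obtain ⟨v, hv₀, hv⟩ := hμ
  have hne : Nonempty (Fin M) := by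
    obtain ⟨k, -⟩ := Function.ne_iff.1 hv₀
    exact ⟨k⟩
  obtain ⟨i, hi⟩ := Finite.exists_max fun i => ‖v i‖ / ν i
  set r := ‖v i‖ / ν i with hr
  have hvr : ∀ j, ‖v j‖ ≤ r * ν j := fun j => (div_le_iff₀ (hν j)).1 (hi j)
  have hvi : ‖v i‖ = r * ν i := by rw [hr, div_mul_cancel₀ _ (hν i).ne']
  have hr₀ : 0 < r := by
    obtain ⟨k, hk⟩ := Function.ne_iff.1 hv₀
    exact (div_pos (norm_pos_iff.2 hk) (hν k)).trans_le (hi k)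
  have hsum : (μ - A i i) * v i = ∑ j ∈ Finset.univ.erase i, (A i j : ℂ) * v j := by
    have h := congrFun hv i
    simp only [sub_mulVec, Pi.sub_apply, scalar_apply, mulVec_diagonal, Pi.zero_apply] at h
    simp only [mulVec, dotProduct, map_apply, Complex.coe_algebraMap] at h
    rw [← Finset.add_sum_erase _ _ (Finset.mem_univ i)] at h
    linear_combination h
  have hbound : ‖μ - A i i‖ * (r * ν i) ≤ r * ∑ j ∈ Finset.univ.erase i, A i j * ν j := by
    rw [← hvi, ← norm_mul, hsum, Finset.mul_sum]
    refine norm_sum_le_of_le _ fun j hj => ?_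
    have hij := hA i j (Finset.ne_of_mem_erase hj).symm
    rw [norm_mul, Complex.norm_of_nonneg hij]
    calc A i j * ‖v j‖ ≤ A i j * (r * ν j) := by gcongr; exact hvr j
      _ = r * (A i j * ν j) := by ring
  have hrow := hAν i
  rw [mulVec, dotProduct, ← Finset.add_sum_erase _ _ (Finset.mem_univ i)] at hrow
  have hlt : ‖μ - A i i‖ * (r * ν i) < -A i i * (r * ν i) := by
    nlinarith
  have hre := (Complex.re_le_norm _).trans_lt (lt_of_mul_lt_mul_right hlt (mul_pos hr₀ (hν i)).le)
  simp only [Complex.sub_re, Complex.ofReal_re] at hre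
  linarith

theorem IsHurwitz.det_scalar_sub_ne_zero {M : ℕ} {A : Matrix (Fin M) (Fin M) ℝ}
    (hA : A.IsHurwitz) {t : ℝ} (ht : 0 ≤ t) : (scalar (Fin M) t - A).det ≠ 0 := by
  intro h
  rw [← eval_charpoly] at h
  have hroot := hA t <| by
    rw [charpoly_map]
    exact Polynomial.IsRoot.map (f := algebraMap ℝ ℂ) h
  exact hroot.not_ge (by simpa using ht)

theorem IsMetzler.pos_of_mulVec_lt {M : ℕ} {A : Matrix (Fin M) (Fin M) ℝ} (hA : A.IsMetzler)
    {x : Fin M → ℝ} {i : Fin M} {t : ℝ} (hx : ∀ j, x i ≤ x j) (hxA : (A *ᵥ x) i < t * x i)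
    (ht : x i = 0 ∨ ∑ j, A i j ≤ t) : 0 < x i := by
  by_contra! hneg
  have hle : (∑ j, A i j) * x i ≤ (A *ᵥ x) i := by
    rw [Finset.sum_mul]
    refine Finset.sum_le_sum fun j _ => ?_
    rcases eq_or_ne i j with rfl | hij
    · rfl
    · exact mul_le_mul_of_nonneg_left (hx j) (hA i j hij)
  rcases ht with h | h
  · simp only [h, mul_zero] at hle hxA
    linarith
  · nlinarith

theorem IsHurwitz.exists_pos_vec {M : ℕ} [NeZero M] {A : Matrix (Fin M) (Fin M) ℝ}
    (hH : A.IsHurwitz) (hA : A.IsMetzler) :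
    ∃ ν : Fin M → ℝ, (∀ i, 0 < ν i) ∧ ∀ i, (A *ᵥ ν) i < 0 := by
  let B : ℝ → Matrix (Fin M) (Fin M) ℝ := fun t => scalar (Fin M) t - A
  let x : ℝ → Fin M → ℝ := fun t => (B t).det⁻¹ • ((B t).adjugate *ᵥ 1)
  have hB : Continuous B := by
    refine Continuous.sub ?_ continuous_const
    exact Continuous.matrix_diagonal (continuous_pi fun _ => continuous_id)
  have hx : ∀ t, 0 ≤ t → ∀ i, (A *ᵥ x t) i = t * x t i - 1 := by
    intro t ht i
    have h : B t *ᵥ x t = 1 := by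
      rw [mulVec_smul, mulVec_mulVec, mul_adjugate, smul_mulVec, one_mulVec, smul_smul,
        inv_mul_cancel₀ (hH.det_scalar_sub_ne_zero ht), one_smul]
    have hi := congrFun h i
    simp only [B, sub_mulVec, Pi.sub_apply, scalar_apply, mulVec_diagonal, Pi.one_apply] at hi
    linarith
  let f : ℝ → ℝ := fun t => Finset.univ.inf' Finset.univ_nonempty (x t)
  have hmin : ∀ t, ∃ i, f t = x t i ∧ ∀ j, x t i ≤ x t j := by
    intro t
    obtain ⟨i, -, hi⟩ := Finset.exists_mem_eq_inf' Finset.univ_nonempty (x t)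
    exact ⟨i, hi, fun j => hi ▸ Finset.inf'_le _ (Finset.mem_univ j)⟩
  have hf : ContinuousOn f (Set.Ici 0) := by
    refine ContinuousOn.finset_inf'_apply _ fun i _ => ?_
    refine (hB.matrix_det.continuousOn.inv₀ fun t ht => hH.det_scalar_sub_ne_zero ht).mul ?_
    exact ((continuous_apply i).comp
      (hB.matrix_adjugate.matrix_mulVec continuous_const)).continuousOn
  have hf₀ : ∀ t, 0 ≤ t → f t ≠ 0 := by
    intro t ht h
    obtain ⟨i, hi, hle⟩ := hmin t
    have := hA.pos_of_mulVec_lt (t := t) hle (by rw [hx t ht]; linarith) (.inl (hi ▸ h))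
    linarith
  obtain ⟨T, hT⟩ := (Set.finite_range fun i => ∑ j, A i j).bddAbove
  have hfT : 0 < f (max T 0) := by
    obtain ⟨i, hi, hle⟩ := hmin (max T 0)
    rw [hi]
    exact hA.pos_of_mulVec_lt hle (by rw [hx _ (le_max_right _ _)]; linarith)
      (.inr ((hT ⟨i, rfl⟩).trans (le_max_left _ _)))
  have hpos : 0 < f 0 := by
    by_contra! hneg
    obtain ⟨t, ht, h⟩ := intermediate_value_Icc (le_max_right T 0)
      (hf.mono Set.Icc_subset_Ici_self) ⟨hneg, hfT.le⟩
    exact hf₀ t ht.1 h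
  exact ⟨x 0, fun i => hpos.trans_le (Finset.inf'_le _ (Finset.mem_univ i)),
    fun i => by rw [hx 0 le_rfl]; norm_num⟩

end Matrix

theorem metzler_hurwitz_iff_exists_pos_vec (M : ℕ) (hM : 0 < M)
    (𝕄 : Matrix (Fin M) (Fin M) ℝ) (hMetzler : 𝕄.IsMetzler) :
    𝕄.IsHurwitz ↔ ∃ ν : Fin M → ℝ, (∀ i, 0 < ν i) ∧ ∀ i, 𝕄.mulVec ν i < 0 := by
  have : NeZero M := ⟨hM.ne'⟩
  exact ⟨fun h => h.exists_pos_vec hMetzler,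
    fun ⟨_, hν, h⟩ => Matrix.isHurwitz_of_exists_pos_vec hMetzler hν h⟩
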